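/- arXiv:2111.05300 — 5 statements merged into one kernel-verified Lean document; each statement's English description precedes it below -/
import Mathlib

section
/- Let K ≥ 2. The REINFORCE leave-one-out estimator is unbiased: ∫ RLOO(x_{1:K}) dμ^K(x_{1:K}) = ∫ f(x) s(x) dμ(x). -/
open MeasureTheory Finset

open ProbabilityTheory in
/-- Measurable functions of two distinct coordinates are independent under a product of copies of a
probability measure. -/
theorem indepFun_comp_eval_pi {ι X E F : Type*} [Fintype ι] [MeasurableSpace X]
    [MeasurableSpace E] [MeasurableSpace F] {μ : Measure X} [IsProbabilityMeasure μ]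
    {f : X → E} {g : X → F} (hf : Measurable f) (hg : Measurable g) {i j : ι} (hij : i ≠ j) :
    IndepFun (fun x => f (x i)) (fun x => g (x j)) (Measure.pi fun _ : ι => μ) :=
  ((iIndepFun_pi (μ := fun _ : ι => μ) (X := fun _ x => x)
    fun _ => aemeasurable_id).indepFun hij).comp hf hg

/-- The REINFORCE leave-one-out estimator is unbiased. -/
theorem rloo_unbiased
    {X : Type*} [MeasurableSpace X] (μ : Measure X) [IsProbabilityMeasure μ]
    (d : ℕ) (s : X → EuclideanSpace ℝ (Fin d)) (f : X → ℝ)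
    (hs : Measurable s) (hf : Measurable f)
    (hsInt : Integrable s μ) (hfInt : Integrable f μ)
    (hfsInt : Integrable (fun x => f x • s x) μ)
    (hs0 : ∫ x, s x ∂μ = 0)
    (K : ℕ) (hK : 2 ≤ K) :
    ∫ x, (K : ℝ)⁻¹ •
        ∑ k, (f (x k) - ((K : ℝ) - 1)⁻¹ * ∑ j ∈ univ.erase k, f (x j)) • s (x k)
        ∂(Measure.pi fun _ : Fin K => μ)
      = ∫ y, f y • s y ∂μ := by
  have hfEval (k : Fin K) : Integrable (fun x => f (x k)) (Measure.pi fun _ : Fin K => μ) :=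
    integrable_comp_eval (μ := fun _ : Fin K => μ) hfInt
  have hsEval (k : Fin K) : Integrable (fun x => s (x k)) (Measure.pi fun _ : Fin K => μ) :=
    integrable_comp_eval (μ := fun _ : Fin K => μ) hsInt
  have hdiag (k : Fin K) :
      Integrable (fun x => f (x k) • s (x k)) (Measure.pi fun _ : Fin K => μ) :=
    integrable_comp_eval (μ := fun _ : Fin K => μ) (f := fun y => f y • s y) hfsInt
  have hcross (k : Fin K) : ∀ j ∈ univ.erase k,
      Integrable (fun x => f (x j) • s (x k)) (Measure.pi fun _ : Fin K => μ) := fun j hj =>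
    (indepFun_comp_eval_pi hf hs (ne_of_mem_erase hj)).integrable_smul
      (hfEval j) (hsEval k)
  have hcross_zero (k : Fin K) : ∀ j ∈ univ.erase k,
      ∫ x, f (x j) • s (x k) ∂(Measure.pi fun _ : Fin K => μ) = 0 := fun j hj => by
    rw [(indepFun_comp_eval_pi hf hs (ne_of_mem_erase hj)).integral_fun_smul_eq_smul_integral
      (hfEval j).aestronglyMeasurable (hsEval k).aestronglyMeasurable,
      integral_comp_eval (μ := fun _ : Fin K => μ) (f := s) hsInt.aestronglyMeasurable,
      hs0, smul_zero]
  have hcross_sum (k : Fin K) :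
      Integrable (fun x => ((K : ℝ) - 1)⁻¹ • ∑ j ∈ univ.erase k, f (x j) • s (x k))
        (Measure.pi fun _ : Fin K => μ) :=
    (integrable_finsetSum _ (hcross k)).smul ((K : ℝ) - 1)⁻¹
  have hterm (k : Fin K) :
      ∫ x, (f (x k) • s (x k) - ((K : ℝ) - 1)⁻¹ • ∑ j ∈ univ.erase k, f (x j) • s (x k))
        ∂(Measure.pi fun _ : Fin K => μ) = ∫ y, f y • s y ∂μ := by
    rw [integral_sub (hdiag k) (hcross_sum k), integral_smul,
      integral_finsetSum _ (hcross k), sum_eq_zero (hcross_zero k), smul_zero, sub_zero,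
      integral_comp_eval (μ := fun _ : Fin K => μ) (f := fun y => f y • s y)
        hfsInt.aestronglyMeasurable]
  have hK0 : (K : ℝ) ≠ 0 := Nat.cast_ne_zero.mpr (by omega)
  simp only [sub_smul, mul_smul, sum_smul]
  rw [integral_smul, integral_finsetSum _ fun k _ => by exact (hdiag k).sub (hcross_sum k)]
  simp only [hterm, sum_const, card_univ, Fintype.card_fin]
  rw [← Nat.cast_smul_eq_nsmul ℝ, inv_smul_smul₀ hK0]
end

section
/- Let K ≥ 2 and let γ_1,…,γ_K : X^K → ℝ be measurable with each γ_k(x_{1:K})·s(x_k) μ^K-integrable. Define the correction c_k(x_{1:k−1,k+1:K}) = ∫ γ_k(x_{1:K}) s(x_k) dμ(x_k) (an integral over the k-th coordinate only). Then the estimator with general sample-specific control variates, (1/K) Σ_{k=1}^K ( f(x_k) − γ_k(x_{1:K}) ) s(x_k) + (1/K) Σ_{k=1}^K c_k(x_{1:k−1,k+1:K}), is unbiased: its integral with respect to μ^K equals ∫ f(x) s(x) dμ(x). -/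
open MeasureTheory Finset

/-- Resampling one coordinate of a product of probability measures preserves the product. -/
theorem measurePreserving_update_pi {ι : Type*} [Fintype ι] [DecidableEq ι] {X : ι → Type*}
    [∀ i, MeasurableSpace (X i)] (μ : ∀ i, Measure (X i)) [∀ i, IsProbabilityMeasure (μ i)]
    (k : ι) :
    MeasurePreserving (fun p : (∀ i, X i) × X k => Function.update p.1 k p.2)
      ((Measure.pi μ).prod (μ k)) (Measure.pi μ) := by
  have hmeas : Measurable (fun p : (∀ i, X i) × X k => Function.update p.1 k p.2) :=
    measurable_update'
  refine ⟨hmeas, (Measure.pi_eq fun t ht => ?_).symm⟩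
  have hpre : (fun p : (∀ i, X i) × X k => Function.update p.1 k p.2) ⁻¹' Set.univ.pi t
      = (Set.univ.pi (Function.update t k Set.univ)) ×ˢ t k := by
    ext ⟨x, a⟩
    simp only [Set.mem_preimage, Set.mem_univ_pi, Set.mem_prod]
    rw [Function.forall_update_iff x (fun i y => y ∈ t i),
      Function.forall_update_iff t (fun i u => x i ∈ u)]
    simp [and_comm]
  rw [Measure.map_apply hmeas (.univ_pi ht), hpre, Measure.prod_prod, Measure.pi_pi,
    ← Finset.prod_erase_mul _ _ (Finset.mem_univ k),
    ← Finset.prod_erase_mul (a := k) _ (fun i => μ i (t i)) (Finset.mem_univ k)]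
  simp only [Function.update_self, measure_univ, mul_one]
  congr 1
  refine Finset.prod_congr rfl fun i hi => ?_
  rw [Function.update_of_ne (Finset.ne_of_mem_erase hi)]

section PartialIntegral

variable {ι E : Type*} [Fintype ι] [DecidableEq ι] {X : ι → Type*}
  [∀ i, MeasurableSpace (X i)] (μ : ∀ i, Measure (X i)) [∀ i, IsProbabilityMeasure (μ i)]
  [NormedAddCommGroup E] {g : (∀ i, X i) → E}

theorem integrable_comp_update_pi (k : ι) (hg : Integrable g (Measure.pi μ)) :
    Integrable (fun p : (∀ i, X i) × X k => g (Function.update p.1 k p.2))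
      ((Measure.pi μ).prod (μ k)) :=
  (measurePreserving_update_pi μ k).integrable_comp_of_integrable hg

variable [NormedSpace ℝ E]

theorem integrable_integral_update_pi (k : ι) (hg : Integrable g (Measure.pi μ)) :
    Integrable (fun x => ∫ a, g (Function.update x k a) ∂μ k) (Measure.pi μ) :=
  (integrable_comp_update_pi μ k hg).integral_prod_left

/-- Integrating out one coordinate first does not change the integral over the product. -/
theorem integral_integral_update_pi (k : ι) (hg : Integrable g (Measure.pi μ)) :
    ∫ x, ∫ a, g (Function.update x k a) ∂μ k ∂Measure.pi μ = ∫ x, g x ∂Measure.pi μ := by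
  have hmp := measurePreserving_update_pi μ k
  rw [← integral_prod _ (integrable_comp_update_pi μ k hg)]
  conv_rhs => rw [← hmp.map_eq]
  exact (integral_map hmp.aemeasurable (hmp.map_eq.symm ▸ hg.aestronglyMeasurable)).symm

end PartialIntegral

/-- The estimator with general sample-specific control variates `γ_k` and their analytic
correction terms is unbiased. -/
theorem general_sample_specific_cv_unbiased
    {X : Type*} [MeasurableSpace X] (μ : Measure X) [IsProbabilityMeasure μ]
    (d : ℕ) (s : X → EuclideanSpace ℝ (Fin d)) (f : X → ℝ)
    (hs : Measurable s) (hf : Measurable f)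
    (hsInt : Integrable s μ) (hfInt : Integrable f μ)
    (hfsInt : Integrable (fun x => f x • s x) μ)
    (hs0 : ∫ x, s x ∂μ = 0)
    (K : ℕ) (hK : 2 ≤ K)
    (γ : Fin K → (Fin K → X) → ℝ) (hγ : ∀ k, Measurable (γ k))
    (hγsInt : ∀ k, Integrable (fun x => γ k x • s (x k)) (Measure.pi fun _ : Fin K => μ)) :
    ∫ x, ((K : ℝ)⁻¹ • ∑ k, (f (x k) - γ k x) • s (x k)
        + (K : ℝ)⁻¹ • ∑ k, ∫ a, γ k (Function.update x k a) • s a ∂μ)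
        ∂(Measure.pi fun _ : Fin K => μ)
      = ∫ y, f y • s y ∂μ := by
  have hfs : ∀ k, Integrable (fun x : Fin K → X => f (x k) • s (x k))
      (Measure.pi fun _ : Fin K => μ) := fun k =>
    integrable_comp_eval (μ := fun _ : Fin K => μ) (i := k) hfsInt
  have hfs_integral : ∀ k, ∫ x : Fin K → X, f (x k) • s (x k) ∂(Measure.pi fun _ : Fin K => μ)
      = ∫ y, f y • s y ∂μ := fun k =>
    integral_comp_eval (μ := fun _ : Fin K => μ) (i := k) hfsInt.aestronglyMeasurable
  have hdiff : ∀ k, Integrable (fun x : Fin K → X => (f (x k) - γ k x) • s (x k))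
      (Measure.pi fun _ : Fin K => μ) := fun k => by
    simp only [sub_smul]
    exact (hfs k).sub (hγsInt k)
  have hcorr : ∀ k, Integrable (fun x => ∫ a, γ k (Function.update x k a) • s a ∂μ)
      (Measure.pi fun _ : Fin K => μ) := fun k => by
    simpa only [Function.update_self] using
      integrable_integral_update_pi (fun _ : Fin K => μ) k (hγsInt k)
  have hcorr_integral : ∀ k, ∫ x, ∫ a, γ k (Function.update x k a) • s a ∂μ
      ∂(Measure.pi fun _ : Fin K => μ)
      = ∫ x, γ k x • s (x k) ∂(Measure.pi fun _ : Fin K => μ) := fun k => by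
    simpa only [Function.update_self] using
      integral_integral_update_pi (fun _ : Fin K => μ) k (hγsInt k)
  have hdiff_integral : ∀ k, ∫ x : Fin K → X, (f (x k) - γ k x) • s (x k)
      ∂(Measure.pi fun _ : Fin K => μ)
      = ∫ y, f y • s y ∂μ - ∫ x, γ k x • s (x k) ∂(Measure.pi fun _ : Fin K => μ) := fun k => by
    simp only [sub_smul]
    rw [integral_sub (hfs k) (hγsInt k), hfs_integral]
  have hK0 : (K : ℝ) ≠ 0 := Nat.cast_ne_zero.mpr (by omega)
  rw [integral_add ((integrable_finsetSum _ fun k _ => hdiff k).fun_smul _)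
      ((integrable_finsetSum _ fun k _ => hcorr k).fun_smul _), integral_smul, integral_smul,
    integral_finsetSum _ fun k _ => hdiff k, integral_finsetSum _ fun k _ => hcorr k,
    ← smul_add, ← Finset.sum_add_distrib]
  simp only [hdiff_integral, hcorr_integral, sub_add_cancel, Finset.sum_const, Finset.card_univ,
    Fintype.card_fin]
  rw [← Nat.cast_smul_eq_nsmul ℝ, inv_smul_smul₀ hK0]
end

section
/- Let K ≥ 2, α ∈ ℝ, and let b : X → ℝ be measurable and integrable with b·s μ-integrable. Then the double control variate estimator obtained by applying the leave-one-out procedure to f + αb, namely (1/K) Σ_{k=1}^K [ f(x_k) + α b(x_k) − (1/(K−1)) Σ_{j≠k} ( f(x_j) + α b(x_j) ) ] s(x_k) − α ∫ b(x) s(x) dμ(x), is unbiased: its integral with respect to μ^K equals ∫ f(x) s(x) dμ(x). -/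
open MeasureTheory Finset

section ProductMeasure

lemma sub_mul_sum_smul_eq {X ι E : Type*} [Fintype ι] [DecidableEq ι] [AddCommGroup E]
    [Module ℝ E] (g : X → ℝ) (s : X → E) (c : ℝ) (k : ι) (x : ι → X) :
    (g (x k) - c * ∑ j ∈ univ.erase k, g (x j)) • s (x k)
      = g (x k) • s (x k) - c • ∑ j ∈ univ.erase k, g (x j) • s (x k) := by
  rw [sub_smul, mul_smul, sum_smul]

variable {X ι E : Type*} [MeasurableSpace X] {μ : Measure X} [IsProbabilityMeasure μ]
  [Fintype ι] [MeasurableSpace E] {g : X → ℝ} {s : X → E}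

/-- Distinct coordinates are independent under a finite product of probability measures. -/
lemma indepFun_comp_eval_pi_s7 (hg : AEMeasurable g μ) (hs : AEMeasurable s μ)
    {j k : ι} (hjk : j ≠ k) :
    ProbabilityTheory.IndepFun (fun x : ι → X => g (x j)) (fun x => s (x k))
      (Measure.pi fun _ => μ) := by
  have h := (ProbabilityTheory.iIndepFun_pi (μ := fun _ : ι => μ) (X := fun _ => id)
    fun _ => aemeasurable_id).indepFun hjk
  have hmap (i : ι) : (Measure.pi fun _ : ι => μ).map (fun x => id (x i)) = μ :=
    (measurePreserving_eval (fun _ : ι => μ) i).map_eq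
  exact h.comp₀ (measurable_pi_apply j).aemeasurable (measurable_pi_apply k).aemeasurable
    (by rwa [hmap]) (by rwa [hmap])

variable [NormedAddCommGroup E] [NormedSpace ℝ E] [BorelSpace E]

lemma integrable_smul_comp_eval_pi (hg : Integrable g μ) (hs : Integrable s μ)
    {j k : ι} (hjk : j ≠ k) :
    Integrable (fun x : ι → X => g (x j) • s (x k)) (Measure.pi fun _ => μ) :=
  (indepFun_comp_eval_pi_s7 hg.aemeasurable hs.aemeasurable hjk).integrable_smul
    (integrable_comp_eval (μ := fun _ : ι => μ) hg) (integrable_comp_eval (μ := fun _ : ι => μ) hs)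

lemma integral_smul_comp_eval_pi (hg : Integrable g μ) (hs : Integrable s μ)
    {j k : ι} (hjk : j ≠ k) :
    ∫ x : ι → X, g (x j) • s (x k) ∂(Measure.pi fun _ => μ) = (∫ y, g y ∂μ) • ∫ y, s y ∂μ := by
  rw [(indepFun_comp_eval_pi_s7 hg.aemeasurable hs.aemeasurable hjk).integral_fun_smul_eq_smul_integral
    (integrable_comp_eval (μ := fun _ : ι => μ) hg).aestronglyMeasurable
    (integrable_comp_eval (μ := fun _ : ι => μ) hs).aestronglyMeasurable,
    integral_comp_eval (μ := fun _ : ι => μ) hg.aestronglyMeasurable,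
    integral_comp_eval (μ := fun _ : ι => μ) hs.aestronglyMeasurable]

variable [DecidableEq ι]

lemma integrable_leaveOneOut_term (hg : Integrable g μ) (hs : Integrable s μ)
    (hgs : Integrable (fun y => g y • s y) μ) (c : ℝ) (k : ι) :
    Integrable (fun x : ι → X => (g (x k) - c * ∑ j ∈ univ.erase k, g (x j)) • s (x k))
      (Measure.pi fun _ => μ) := by
  simp only [sub_mul_sum_smul_eq]
  exact (integrable_comp_eval (μ := fun _ : ι => μ) hgs).sub
    ((integrable_finsetSum _ fun j hj =>
      integrable_smul_comp_eval_pi hg hs (ne_of_mem_erase hj)).fun_smul c)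

/-- Subtracting a multiple of the other coordinates' values does not change the mean against a
centered function of the remaining coordinate. -/
lemma integral_leaveOneOut_term (hg : Integrable g μ) (hs : Integrable s μ)
    (hgs : Integrable (fun y => g y • s y) μ) (hs0 : ∫ y, s y ∂μ = 0) (c : ℝ) (k : ι) :
    ∫ x : ι → X, (g (x k) - c * ∑ j ∈ univ.erase k, g (x j)) • s (x k) ∂(Measure.pi fun _ => μ)
      = ∫ y, g y • s y ∂μ := by
  have hcross : ∀ j ∈ univ.erase k,
      Integrable (fun x : ι → X => g (x j) • s (x k)) (Measure.pi fun _ => μ) := fun j hj =>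
    integrable_smul_comp_eval_pi hg hs (ne_of_mem_erase hj)
  simp only [sub_mul_sum_smul_eq]
  rw [integral_sub (integrable_comp_eval (μ := fun _ : ι => μ) hgs)
      ((integrable_finsetSum _ hcross).fun_smul c),
    integral_comp_eval (μ := fun _ : ι => μ) hgs.aestronglyMeasurable, integral_smul,
    integral_finsetSum _ hcross, sum_eq_zero, smul_zero, sub_zero]
  intro j hj
  rw [integral_smul_comp_eval_pi hg hs (ne_of_mem_erase hj), hs0, smul_zero]

end ProductMeasure


/-- The double control variate estimator, obtained by applying the leave-one-out procedure
to `f + α b` together with the analytic global correction, is unbiased. -/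
theorem double_cv_unbiased
    {X : Type*} [MeasurableSpace X] (μ : Measure X) [IsProbabilityMeasure μ]
    (d : ℕ) (s : X → EuclideanSpace ℝ (Fin d)) (f b : X → ℝ)
    (hs : Measurable s) (hf : Measurable f) (hb : Measurable b)
    (hsInt : Integrable s μ) (hfInt : Integrable f μ) (hbInt : Integrable b μ)
    (hfsInt : Integrable (fun x => f x • s x) μ)
    (hbsInt : Integrable (fun x => b x • s x) μ)
    (hs0 : ∫ x, s x ∂μ = 0)
    (K : ℕ) (hK : 2 ≤ K) (α : ℝ) :
    ∫ x, ((K : ℝ)⁻¹ •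
        ∑ k, (f (x k) + α * b (x k)
          - ((K : ℝ) - 1)⁻¹ * ∑ j ∈ univ.erase k, (f (x j) + α * b (x j))) • s (x k)
        - α • ∫ y, b y • s y ∂μ)
        ∂(Measure.pi fun _ : Fin K => μ)
      = ∫ y, f y • s y ∂μ := by
  have hg : Integrable (fun y => f y + α * b y) μ := hfInt.add (hbInt.const_mul α)
  have hsplit (y : X) : (f y + α * b y) • s y = f y • s y + α • b y • s y := by
    rw [add_smul, mul_smul]
  have hgs : Integrable (fun y => (f y + α * b y) • s y) μ := by
    simp only [hsplit]
    exact hfsInt.add (hbsInt.fun_smul α)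
  have hterm (k : Fin K) := integrable_leaveOneOut_term hg hsInt hgs ((K : ℝ) - 1)⁻¹ k
  have hK0 : (K : ℝ) ≠ 0 := by positivity
  rw [integral_sub ((integrable_finsetSum _ fun k _ => hterm k).fun_smul _) (integrable_const _),
    integral_smul, integral_finsetSum _ fun k _ => hterm k,
    sum_congr rfl fun k _ => integral_leaveOneOut_term hg hsInt hgs hs0 ((K : ℝ) - 1)⁻¹ k]
  simp only [hsplit]
  rw [integral_add hfsInt (hbsInt.fun_smul α), integral_smul, sum_const, card_univ, Fintype.card_fin,
    ← Nat.cast_smul_eq_nsmul ℝ, inv_smul_smul₀ hK0, integral_const, probReal_univ, one_smul,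
    add_sub_cancel_right]
end

section
/- Let K ≥ 2 and let j, k ∈ {1,…,K} with j ≠ k. Then the double control variate paired with sample j has zero correlation with the score of sample k: ∫ b_j(x_{1:K}) s(x_k) dμ^K(x_{1:K}) = 0, where b_j(x_{1:K}) = ⟨ (1/(K−1)) Σ_{m≠j} g(x_m), x_j − m ⟩. -/
open MeasureTheory Finset
open scoped RealInnerProductSpace

/-- Pairing a centred variable with a vector that does not depend on it, and weighting by a further
independent vector, integrates to zero over the product space. No integrability of the integrand is
needed, since the Bochner integral of a non-integrable function is zero. -/
theorem integral_prod_inner_sub_mean_smul_eq_zero {E F Y : Type*}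
    [NormedAddCommGroup E] [InnerProductSpace ℝ E] [CompleteSpace E] [MeasurableSpace E]
    [NormedAddCommGroup F] [NormedSpace ℝ F] [CompleteSpace F] [MeasurableSpace Y]
    (μ : Measure E) [IsProbabilityMeasure μ] (ν : Measure Y) [SFinite ν]
    (hμ : Integrable (fun x => x) μ) (G : Y → E) (S : Y → F) :
    ∫ z, ⟪G z.2, z.1 - ∫ x, x ∂μ⟫ • S z.2 ∂(μ.prod ν) = 0 := by
  by_cases hint : Integrable (fun z : E × Y => ⟪G z.2, z.1 - ∫ x, x ∂μ⟫ • S z.2) (μ.prod ν)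
  · rw [integral_prod_symm _ hint]
    refine integral_eq_zero_of_ae (.of_forall fun y => ?_)
    have hc : Integrable (fun x => x - ∫ x, x ∂μ) μ := hμ.sub (integrable_const _)
    simp only [Pi.zero_apply]
    rw [integral_smul_const, integral_inner hc, integral_sub hμ (integrable_const _)]
    simp
  · exact integral_undef hint

/-- A sum over all indices other than `j` is a sum over the image of `j.succAbove`. -/
theorem sum_erase_eq_sum_succAbove {M : Type*} [AddCommMonoid M] {n : ℕ} (j : Fin (n + 1))
    (f : Fin (n + 1) → M) : ∑ i ∈ univ.erase j, f i = ∑ i, f (j.succAbove i) := by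
  have himage : univ.erase j = univ.image j.succAbove := by
    rw [Fin.image_succAbove_univ]
    ext i
    simp
  rw [himage, sum_image Fin.succAbove_right_injective.injOn]

/-- The double control variate paired with sample `j` has zero correlation with the
score of a different sample `k`. -/
theorem double_cv_other_sample_score_zero
    (D d : ℕ) (μ : Measure (EuclideanSpace ℝ (Fin D))) [IsProbabilityMeasure μ]
    (s : EuclideanSpace ℝ (Fin D) → EuclideanSpace ℝ (Fin d))
    (g : EuclideanSpace ℝ (Fin D) → EuclideanSpace ℝ (Fin D))
    (hs : Measurable s) (hg : Measurable g)
    (m : EuclideanSpace ℝ (Fin D)) (hm : m = ∫ x, x ∂μ)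
    (hidInt : Integrable (fun x => x) μ)
    (hsInt : Integrable s μ) (hgInt : Integrable g μ)
    (hgsInt : Integrable (fun x => ‖g x‖ * ‖s x‖) μ)
    (K : ℕ) (hK : 2 ≤ K) (j k : Fin K) (hjk : j ≠ k)
    (b : Fin K → (Fin K → EuclideanSpace ℝ (Fin D)) → ℝ)
    (hb : ∀ k' x, b k' x =
      ⟪((K : ℝ) - 1)⁻¹ • ∑ j' ∈ univ.erase k', g (x j'), x k' - m⟫) :
    ∫ x, b j x • s (x k) ∂(Measure.pi fun _ : Fin K => μ) = 0 := by
  obtain ⟨n, rfl⟩ : ∃ n, K = n + 1 := ⟨K - 1, by omega⟩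
  obtain ⟨i, rfl⟩ := Fin.exists_succAbove_eq hjk.symm
  have hmp := (measurePreserving_piFinSuccAbove
    (fun _ : Fin (n + 1) => μ) j).symm
  rw [← hmp.integral_comp', ← integral_prod_inner_sub_mean_smul_eq_zero μ
    (Measure.pi fun _ : Fin n => μ) hidInt
    (fun y => (((n + 1 : ℕ) : ℝ) - 1)⁻¹ • ∑ l, g (y l)) (fun y => s (y i))]
  refine integral_congr_ae (.of_forall fun z => ?_)
  have hz : (MeasurableEquiv.piFinSuccAbove (fun _ => EuclideanSpace ℝ (Fin D)) j).symm z
      = j.insertNth z.1 z.2 := rfl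
  simp only [hb, hm, hz, sum_erase_eq_sum_succAbove, Fin.insertNth_apply_same,
    Fin.insertNth_apply_succAbove]
end

section
/- Let K ≥ 2 and k ∈ {1,…,K}. Then ∫ b_k(x_{1:K}) s(x_k) dμ^K(x_{1:K}) = M ( ∫ g dμ ), where b_k(x_{1:K}) = ⟨ (1/(K−1)) Σ_{j≠k} g(x_j), x_k − m ⟩ and M = ∫ s(x)(x − m)ᵀ dμ(x). Consequently the expectation of the leave-one-out double control variate paired with the current sample's score equals the matrix M applied to the mean of g. -/
open MeasureTheory Finset
open scoped RealInnerProductSpace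

/-- Two distinct coordinates of an i.i.d. family have the product measure as joint law. -/
lemma measurePreserving_eval_prodMk_eval {ι X : Type*} [Fintype ι] [MeasurableSpace X]
    (μ : Measure X) [IsProbabilityMeasure μ] {j k : ι} (hjk : j ≠ k) :
    MeasurePreserving (fun x : ι → X => (x j, x k)) (Measure.pi fun _ => μ) (μ.prod μ) := by
  refine ⟨by fun_prop, ?_⟩
  have hind := (ProbabilityTheory.iIndepFun_pi (μ := fun _ : ι => μ) (X := fun _ => id)
    fun _ => aemeasurable_id).indepFun hjk
  have hmap := (ProbabilityTheory.indepFun_iff_map_prod_eq_prod_map_map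
    (measurable_pi_apply j).aemeasurable (measurable_pi_apply k).aemeasurable).1 hind
  simpa [(measurePreserving_eval (fun _ : ι => μ) _).map_eq, Function.eval] using hmap

section CrossMoment

variable {D d : ℕ} {μ : Measure (EuclideanSpace ℝ (Fin D))}
  {s : EuclideanSpace ℝ (Fin D) → EuclideanSpace ℝ (Fin d)}
  {g : EuclideanSpace ℝ (Fin D) → EuclideanSpace ℝ (Fin D)}
  {m : EuclideanSpace ℝ (Fin D)} {M : Matrix (Fin d) (Fin D) ℝ}

lemma integrable_inner_sub_smul (hs : Measurable s)
    (hsx : Integrable (fun x => ‖s x‖ * ‖x - m‖) μ) (y : EuclideanSpace ℝ (Fin D)) :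
    Integrable (fun x => ⟪y, x - m⟫ • s x) μ := by
  refine (hsx.const_mul ‖y‖).mono' (by fun_prop) (.of_forall fun x => ?_)
  rw [norm_smul]
  calc ‖⟪y, x - m⟫‖ * ‖s x‖ ≤ (‖y‖ * ‖x - m‖) * ‖s x‖ := by
        gcongr
        exact norm_inner_le_norm _ _
    _ = _ := by ring

/-- The cross moment matrix `M` represents the map `y ↦ ∫ ⟪y, x - m⟫ • s x`. -/
lemma integral_inner_sub_smul (hs : Measurable s)
    (hsx : Integrable (fun x => ‖s x‖ * ‖x - m‖) μ)
    (hM : ∀ i j, M i j = ∫ x, s x i * (x j - m j) ∂μ) (y : EuclideanSpace ℝ (Fin D)) :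
    ∫ x, ⟪y, x - m⟫ • s x ∂μ = Matrix.toEuclideanLin M y := by
  have hcoord : ∀ i j, Integrable (fun x => s x i * (x j - m j)) μ := fun i j => by
    refine hsx.mono' (by fun_prop) (.of_forall fun x => ?_)
    rw [norm_mul]
    gcongr
    · exact PiLp.norm_apply_le (s x) i
    · exact PiLp.norm_apply_le (x - m) j
  ext i
  have hproj := (EuclideanSpace.proj (𝕜 := ℝ) i).integral_comp_comm
    (integrable_inner_sub_smul hs hsx y)
  refine hproj.symm.trans ?_
  simp only [Matrix.toLpLin_apply, Matrix.mulVec, dotProduct, hM, ← integral_mul_const]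
  rw [← integral_finsetSum _ fun j _ => (hcoord i j).mul_const _]
  congr 1 with x
  simp only [PiLp.proj_apply, PiLp.smul_apply, smul_eq_mul, PiLp.inner_apply, PiLp.sub_apply, sum_mul,
    RCLike.inner_apply, conj_trivial]
  exact sum_congr rfl fun j _ => by ring

lemma integrable_prod_inner_sub_smul (hs : Measurable s) (hg : Measurable g)
    (hgInt : Integrable g μ) (hsx : Integrable (fun x => ‖s x‖ * ‖x - m‖) μ) :
    Integrable (fun p : EuclideanSpace ℝ (Fin D) × EuclideanSpace ℝ (Fin D) =>
      ⟪g p.1, p.2 - m⟫ • s p.2) (μ.prod μ) := by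
  refine (hgInt.norm.mul_prod hsx).mono' (by fun_prop) (.of_forall fun p => ?_)
  rw [norm_smul]
  calc ‖⟪g p.1, p.2 - m⟫‖ * ‖s p.2‖ ≤ (‖g p.1‖ * ‖p.2 - m‖) * ‖s p.2‖ := by
        gcongr
        exact norm_inner_le_norm _ _
    _ = _ := by ring

lemma integral_prod_inner_sub_smul [SFinite μ] (hs : Measurable s) (hg : Measurable g)
    (hgInt : Integrable g μ) (hsx : Integrable (fun x => ‖s x‖ * ‖x - m‖) μ)
    (hM : ∀ i j, M i j = ∫ x, s x i * (x j - m j) ∂μ) :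
    ∫ p, ⟪g p.1, p.2 - m⟫ • s p.2 ∂(μ.prod μ) = Matrix.toEuclideanLin M (∫ y, g y ∂μ) := by
  rw [integral_prod _ (integrable_prod_inner_sub_smul hs hg hgInt hsx)]
  simp only [integral_inner_sub_smul hs hsx hM]
  exact (Matrix.toEuclideanLin M).toContinuousLinearMap.integral_comp_comm hgInt

end CrossMoment

/-- The expectation of the leave-one-out double control variate paired with the current
sample's score equals the correction matrix `M` applied to the mean of `g`. -/
theorem double_cv_same_sample_score_correction
    (D d : ℕ) (μ : Measure (EuclideanSpace ℝ (Fin D))) [IsProbabilityMeasure μ]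
    (s : EuclideanSpace ℝ (Fin D) → EuclideanSpace ℝ (Fin d))
    (g : EuclideanSpace ℝ (Fin D) → EuclideanSpace ℝ (Fin D))
    (hs : Measurable s) (hg : Measurable g)
    (m : EuclideanSpace ℝ (Fin D)) (hm : m = ∫ x, x ∂μ)
    (hidInt : Integrable (fun x => x) μ)
    (hsInt : Integrable s μ) (hgInt : Integrable g μ)
    (hsxInt : Integrable (fun x => ‖s x‖ * ‖x - m‖) μ)
    (M : Matrix (Fin d) (Fin D) ℝ)
    (hM : ∀ i j, M i j = ∫ x, s x i * (x j - m j) ∂μ)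
    (K : ℕ) (hK : 2 ≤ K) (k : Fin K)
    (b : Fin K → (Fin K → EuclideanSpace ℝ (Fin D)) → ℝ)
    (hb : ∀ k' x, b k' x =
      ⟪((K : ℝ) - 1)⁻¹ • ∑ j' ∈ univ.erase k', g (x j'), x k' - m⟫) :
    ∫ x, b k x • s (x k) ∂(Measure.pi fun _ : Fin K => μ)
      = Matrix.toEuclideanLin M (∫ y, g y ∂μ) := by
  have hpair : ∀ j ∈ univ.erase k,
      MeasurePreserving (fun x : Fin K → EuclideanSpace ℝ (Fin D) => (x j, x k))
        (Measure.pi fun _ => μ) (μ.prod μ) :=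
    fun j hj => measurePreserving_eval_prodMk_eval μ (ne_of_mem_erase hj)
  have hprod := integrable_prod_inner_sub_smul hs hg hgInt hsxInt
  have hint : ∀ j ∈ univ.erase k,
      Integrable (fun x : Fin K → EuclideanSpace ℝ (Fin D) => ⟪g (x j), x k - m⟫ • s (x k))
        (Measure.pi fun _ => μ) :=
    fun j hj => (hpair j hj).integrable_comp_of_integrable hprod
  have hval : ∀ j ∈ univ.erase k,
      ∫ x : Fin K → EuclideanSpace ℝ (Fin D), ⟪g (x j), x k - m⟫ • s (x k)
        ∂(Measure.pi fun _ => μ) = Matrix.toEuclideanLin M (∫ y, g y ∂μ) := fun j hj => by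
    rw [← integral_prod_inner_sub_smul hs hg hgInt hsxInt hM, ← (hpair j hj).map_eq,
      integral_map (hpair j hj).aemeasurable
        ((hpair j hj).map_eq ▸ hprod.aestronglyMeasurable)]
  have hK1 : (K : ℝ) - 1 ≠ 0 := by
    have : (2 : ℝ) ≤ K := by exact_mod_cast hK
    linarith
  simp only [hb, real_inner_smul_left, sum_inner, mul_smul, sum_smul]
  rw [integral_smul, integral_finsetSum _ hint, sum_congr rfl hval, sum_const,
    card_erase_of_mem (mem_univ k), card_univ, Fintype.card_fin, ← Nat.cast_smul_eq_nsmul ℝ,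
    Nat.cast_sub (by omega), Nat.cast_one, inv_smul_smul₀ hK1]
end
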